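/- arXiv:2006.03449 — 6 statements merged into one kernel-verified Lean document; each statement's English description precedes it below -/
import Mathlib

section
/- Let n ≥ 3 and let ⟨·,·⟩ denote the Euclidean inner product on ℝⁿ. A symmetric bilinear map B : ℝⁿ × ℝⁿ → ℝⁿ belongs to the conformal symbol prolongation ĝ₂ (i.e. for every u ∈ ℝⁿ there exists λ(u) ∈ ℝ such that ⟨B(u,v), w⟩ + ⟨v, B(u,w)⟩ = λ(u)⟨v,w⟩ for all v, w) if and only if there exists a vector a ∈ ℝⁿ such that B(u,v) = ⟨a,u⟩v + ⟨a,v⟩u − ⟨u,v⟩a for all u, v ∈ ℝⁿ. In particular ĝ₂ has dimension n. -/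
open scoped RealInnerProductSpace

theorem conf_aux {E : Type*} [NormedAddCommGroup E] [InnerProductSpace ℝ E]
    [FiniteDimensional ℝ E] (e : E) (he : ⟪e, e⟫ = 1)
    (B : E →ₗ[ℝ] E →ₗ[ℝ] E) (hB : ∀ u v, B u v = B v u) :
    (∀ u, ∃ lam : ℝ, ∀ v w, ⟪B u v, w⟫ + ⟪v, B u w⟫ = lam * ⟪v, w⟫) ↔
      (∃ a : E, ∀ u v, B u v = ⟪a, u⟫ • v + ⟪a, v⟫ • u - ⟪u, v⟫ • a) := by
  constructor
  · intro h
    let f : E →ₗ[ℝ] ℝ := (innerₗ E e) ∘ₗ (B.flip e)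
    let a : E := (InnerProductSpace.toDual ℝ E).symm (LinearMap.toContinuousLinearMap f)
    have ha : ∀ u, ⟪a, u⟫ = ⟪e, B u e⟫ := by
      intro u
      simp [a, f]
    have key : ∀ u v w, ⟪B u v, w⟫ + ⟪B u w, v⟫ = 2 * ⟪a, u⟫ * ⟪v, w⟫ := by
      intro u v w
      obtain ⟨l, hl⟩ := h u
      have h1 := hl e e
      have h2 := hl v w
      rw [real_inner_comm, he] at h1
      have h3 : l = 2 * ⟪e, B u e⟫ := by linarith
      rw [ha, ← h3, ← h2, real_inner_comm v (B u w)]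
    refine ⟨a, fun u v => ?_⟩
    refine ext_inner_right ℝ fun w => ?_
    have k1 := key u v w
    have k2 := key v w u
    have k3 := key w u v
    rw [hB w u, hB w v] at k3
    rw [hB v u] at k2
    rw [inner_sub_left, inner_add_left, real_inner_smul_left, real_inner_smul_left,
      real_inner_smul_left]
    rw [real_inner_comm u w] at k2
    linarith
  · rintro ⟨a, ha⟩ u
    refine ⟨2 * ⟪a, u⟫, fun v w => ?_⟩
    rw [ha, ha]
    simp only [inner_sub_left, inner_add_left, real_inner_smul_left, inner_sub_right,
      inner_add_right, real_inner_smul_right]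
    rw [real_inner_comm v a, real_inner_comm v u]
    ring

/-- The map `a ↦ B_a`. -/
noncomputable def confMap (E : Type*) [NormedAddCommGroup E] [InnerProductSpace ℝ E] :
    E →ₗ[ℝ] E →ₗ[ℝ] E →ₗ[ℝ] E where
  toFun a := LinearMap.mk₂ ℝ (fun u v => ⟪a, u⟫ • v + ⟪a, v⟫ • u - ⟪u, v⟫ • a)
    (by intros; simp only [inner_add_right, inner_add_left]; module)
    (by intros; simp only [real_inner_smul_right, real_inner_smul_left]; module)
    (by intros; simp only [inner_add_right]; module)
    (by intros; simp only [real_inner_smul_right]; module)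
  map_add' := by
    intros; ext u v : 2; simp only [LinearMap.mk₂_apply, LinearMap.add_apply, inner_add_left]; module
  map_smul' := by
    intros; ext u v : 2
    simp only [LinearMap.mk₂_apply, LinearMap.smul_apply, real_inner_smul_left, RingHom.id_apply]
    module

theorem confMap_apply {E : Type*} [NormedAddCommGroup E] [InnerProductSpace ℝ E] (a u v : E) :
    confMap E a u v = ⟪a, u⟫ • v + ⟪a, v⟫ • u - ⟪u, v⟫ • a := rfl

theorem confMap_inj (E : Type*) [NormedAddCommGroup E] [InnerProductSpace ℝ E] :
    Function.Injective (confMap E) := by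
  rw [injective_iff_map_eq_zero]
  intro a h
  have h1 : confMap E a a a = 0 := by rw [h]; rfl
  rw [confMap_apply, add_sub_cancel_right] at h1
  rcases smul_eq_zero.1 h1 with h2 | h2
  · exact inner_self_eq_zero.1 h2
  · exact h2

/-- For `n ≥ 3`, a symmetric bilinear map `B : ℝⁿ × ℝⁿ → ℝⁿ` belongs to the
first prolongation `ghat₂` of the conformal Killing symbol (i.e. for every `u` there is
`λ(u) ∈ ℝ` with `⟨B(u,v),w⟩ + ⟨v,B(u,w)⟩ = λ(u)⟨v,w⟩`) iff there is a vector `a ∈ ℝⁿ` with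
`B(u,v) = ⟨a,u⟩v + ⟨a,v⟩u − ⟨u,v⟩a`; in particular `ghat₂` has dimension `n`. -/
theorem conformal_symbol_first_prolongation (n : ℕ) (hn : 3 ≤ n)
    (ghat₂ : Submodule ℝ (EuclideanSpace ℝ (Fin n) →ₗ[ℝ] EuclideanSpace ℝ (Fin n) →ₗ[ℝ]
      EuclideanSpace ℝ (Fin n)))
    (hghat₂ : ∀ B, B ∈ ghat₂ ↔
      ((∀ u v, B u v = B v u) ∧
       ∀ u, ∃ lam : ℝ, ∀ v w, ⟪B u v, w⟫ + ⟪v, B u w⟫ = lam * ⟪v, w⟫)) :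
    (∀ B : EuclideanSpace ℝ (Fin n) →ₗ[ℝ] EuclideanSpace ℝ (Fin n) →ₗ[ℝ]
        EuclideanSpace ℝ (Fin n), (∀ u v, B u v = B v u) →
      ((∀ u, ∃ lam : ℝ, ∀ v w, ⟪B u v, w⟫ + ⟪v, B u w⟫ = lam * ⟪v, w⟫) ↔
        (∃ a : EuclideanSpace ℝ (Fin n), ∀ u v,
          B u v = ⟪a, u⟫ • v + ⟪a, v⟫ • u - ⟪u, v⟫ • a))) ∧
    Module.finrank ℝ ghat₂ = n := by
  have he : ⟪(EuclideanSpace.single (⟨0, by omega⟩ : Fin n) (1 : ℝ)),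
      EuclideanSpace.single (⟨0, by omega⟩ : Fin n) (1 : ℝ)⟫ = 1 := by
    simp
  refine ⟨fun B hB => conf_aux _ he B hB, ?_⟩
  have hr : ghat₂ = LinearMap.range (confMap (EuclideanSpace ℝ (Fin n))) := by
    ext B
    rw [hghat₂, LinearMap.mem_range]
    constructor
    · rintro ⟨hB, h⟩
      obtain ⟨a, ha⟩ := (conf_aux _ he B hB).1 h
      refine ⟨a, ?_⟩
      refine LinearMap.ext fun u => LinearMap.ext fun v => ?_
      rw [ha, confMap_apply]
    · rintro ⟨a, rfl⟩
      have hs : ∀ u v, confMap (EuclideanSpace ℝ (Fin n)) a u v = confMap _ a v u := by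
        intro u v
        rw [confMap_apply, confMap_apply, real_inner_comm u v]
        module
      exact ⟨hs, (conf_aux _ he _ hs).2 ⟨a, confMap_apply a⟩⟩
  rw [hr, LinearMap.finrank_range_of_inj (confMap_inj _), finrank_euclideanSpace_fin]
end

section
/- Let n ≥ 3 and let ⟨·,·⟩ denote the Euclidean inner product on ℝⁿ. If T : ℝⁿ × ℝⁿ × ℝⁿ → ℝⁿ is a symmetric trilinear map such that for all u, v ∈ ℝⁿ there exists λ(u,v) ∈ ℝ with ⟨T(u,v,w), z⟩ + ⟨w, T(u,v,z)⟩ = λ(u,v)⟨w,z⟩ for all w, z ∈ ℝⁿ, then T = 0. (The second prolongation ĝ₃ of the conformal Killing symbol vanishes for all n ≥ 3.) -/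
open scoped RealInnerProductSpace

/-- For `n ≥ 3`, the second prolongation `ĝ₃` of the conformal Killing symbol
vanishes: any symmetric trilinear map `T : ℝⁿ × ℝⁿ × ℝⁿ → ℝⁿ` such that each partial map
`w ↦ T(u,v,w)` is a conformal Killing symbol element (i.e. `⟨T(u,v,w),z⟩ + ⟨w,T(u,v,z)⟩ =
λ(u,v)⟨w,z⟩` for some `λ(u,v) ∈ ℝ`) is zero. -/
theorem conformal_symbol_second_prolongation_vanishes (n : ℕ) (hn : 3 ≤ n)
    (T : EuclideanSpace ℝ (Fin n) →ₗ[ℝ] EuclideanSpace ℝ (Fin n) →ₗ[ℝ]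
      EuclideanSpace ℝ (Fin n) →ₗ[ℝ] EuclideanSpace ℝ (Fin n))
    (hsym₁ : ∀ u v w, T u v w = T v u w)
    (hsym₂ : ∀ u v w, T u v w = T u w v)
    (hconf : ∀ u v, ∃ lam : ℝ, ∀ w z, ⟪T u v w, z⟫ + ⟪w, T u v z⟫ = lam * ⟪w, z⟫) :
    T = 0 := by
  choose L hL using hconf
  have key : ∀ u v w z, 2 * ⟪T u v w, z⟫ = L u v * ⟪w, z⟫ + L u w * ⟪v, z⟫ - L u z * ⟪v, w⟫ := by
    intro u v w z
    have h1 := hL u v w z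
    have h2 := hL u w v z
    have h3 := hL u z v w
    rw [real_inner_comm (T u v z) w] at h1
    rw [real_inner_comm (T u w z) v, hsym₂ u w v] at h2
    rw [real_inner_comm (T u z w) v, hsym₂ u z v, hsym₂ u z w] at h3
    linarith
  have hcross : ∀ u v w z, L u v * ⟪w, z⟫ + L u w * ⟪v, z⟫ - L u z * ⟪v, w⟫
      = L v u * ⟪w, z⟫ + L v w * ⟪u, z⟫ - L v z * ⟪u, w⟫ := by
    intro u v w z
    rw [← key, ← key, hsym₁]
  let e := EuclideanSpace.basisFun (Fin n) ℝ
  have he : ∀ i j, ⟪e i, e j⟫ = if i = j then (1 : ℝ) else 0 :=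
    orthonormal_iff_ite.mp e.orthonormal
  have hLs : ∀ i j, L (e i) (e j) = L (e j) (e i) := by
    intro i j
    have h1 := hL (e i) (e j) (e i) (e i)
    have h2 := hL (e j) (e i) (e i) (e i)
    rw [hsym₁, h2, he] at h1
    simpa using h1.symm
  have hex : ∀ i j : Fin n, ∃ k, k ≠ i ∧ k ≠ j := by
    intro i j
    exact Fin.exists_ne_and_ne_of_two_lt i j (by omega)
  have hoff : ∀ i k, i ≠ k → L (e i) (e k) = 0 := by
    intro i k hik
    obtain ⟨j, hji, hjk⟩ := hex i k
    have h := hcross (e i) (e j) (e k) (e j)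
    simp only [he, hLs j i] at h
    simpa [hik, hik.symm, hji, hji.symm, hjk, hjk.symm] using h
  have hdiag : ∀ i j, i ≠ j → L (e i) (e i) = - L (e j) (e j) := by
    intro i j hij
    have h := hcross (e i) (e j) (e i) (e j)
    simp only [he, hLs j i] at h
    simpa [hij, hij.symm] using h
  have hzero : ∀ i j, L (e i) (e j) = 0 := by
    intro i j
    by_cases hij : i = j
    · subst hij
      obtain ⟨j, hj, -⟩ := hex i i
      obtain ⟨k, hki, hkj⟩ := hex i j
      have h1 := hdiag i j hj.symm
      have h2 := hdiag i k hki.symm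
      have h3 := hdiag j k hkj.symm
      linarith
    · exact hoff i j hij
  refine e.toBasis.ext fun i => e.toBasis.ext fun j => e.toBasis.ext fun k => ?_
  simp only [OrthonormalBasis.coe_toBasis, LinearMap.zero_apply]
  refine InnerProductSpace.ext_inner_right_basis e.toBasis fun l => ?_
  have h := key (e i) (e j) (e k) (e l)
  simp only [hzero] at h
  simp only [OrthonormalBasis.coe_toBasis, inner_zero_left]
  linarith
end

section
/- Let n ≥ 4 and let ⟨·,·⟩ denote the Euclidean inner product on ℝⁿ. Suppose φ assigns to each pair (u,v) ∈ ℝⁿ × ℝⁿ a symmetric bilinear map φ(u,v) : ℝⁿ × ℝⁿ → ℝⁿ, bilinearly and alternatingly in (u,v), such that (i) each φ(u,v) belongs to ĝ₂, i.e. for every w there exists μ ∈ ℝ with ⟨φ(u,v)(w,z), y⟩ + ⟨z, φ(u,v)(w,y)⟩ = μ⟨z,y⟩ for all z, y, and (ii) the cyclic sum φ(u,v)(w,z) + φ(v,w)(u,z) + φ(w,u)(v,z) = 0 for all u, v, w, z ∈ ℝⁿ. Then φ = 0. (The symbol ĝ₂ of the conformal Killing system is 2-acyclic for n ≥ 4.)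 -/
open scoped RealInnerProductSpace

/-- For `n ≥ 4`, the symbol `ĝ₂` of the conformal Killing system is 2-acyclic:
if `φ` assigns, bilinearly and alternatingly in `(u,v)`, to each pair `(u,v)` a symmetric
bilinear map `φ(u,v) : ℝⁿ × ℝⁿ → ℝⁿ` belonging to `ĝ₂` (condition (i)), and the cyclic sum
`φ(u,v)(w,z) + φ(v,w)(u,z) + φ(w,u)(v,z)` vanishes (condition (ii)), then `φ = 0`. -/
theorem conformal_symbol_two_acyclic (n : ℕ) (hn : 4 ≤ n)
    (φ : EuclideanSpace ℝ (Fin n) →ₗ[ℝ] EuclideanSpace ℝ (Fin n) →ₗ[ℝ]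
      EuclideanSpace ℝ (Fin n) →ₗ[ℝ] EuclideanSpace ℝ (Fin n) →ₗ[ℝ] EuclideanSpace ℝ (Fin n))
    (halt : ∀ u v, φ u v = - φ v u)
    (hsym : ∀ u v w z, φ u v w z = φ u v z w)
    (hg₂ : ∀ u v w, ∃ μ : ℝ, ∀ z y, ⟪φ u v w z, y⟫ + ⟪z, φ u v w y⟫ = μ * ⟪z, y⟫)
    (hcyc : ∀ u v w z, φ u v w z + φ v w u z + φ w u v z = 0) :
    φ = 0 := by
  choose μ hμ using hg₂
  have K : ∀ u v w z y, 2 * ⟪φ u v w z, y⟫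
      = μ u v w * ⟪z, y⟫ + μ u v z * ⟪w, y⟫ - μ u v y * ⟪w, z⟫ := by
    intro u v w z y
    have h1 := hμ u v w z y
    have h2 := hμ u v z w y
    have h3 := hμ u v y w z
    rw [hsym u v z w] at h2
    rw [hsym u v y w, hsym u v y z] at h3
    rw [real_inner_comm (φ u v w y) z] at h1
    rw [real_inner_comm (φ u v z y) w] at h2
    rw [real_inner_comm (φ u v z y) w] at h3
    linarith
  let e : Fin n → EuclideanSpace ℝ (Fin n) := fun i => EuclideanSpace.single i 1
  have he : ∀ i j, ⟪e i, e j⟫ = if i = j then (1 : ℝ) else 0 := by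
    intro i j
    simp [e, EuclideanSpace.inner_single_left, eq_comm]
  have C : ∀ i j k l m, (μ (e i) (e j) (e k) * ⟪e l, e m⟫ + μ (e i) (e j) (e l) * ⟪e k, e m⟫
        - μ (e i) (e j) (e m) * ⟪e k, e l⟫)
      + (μ (e j) (e k) (e i) * ⟪e l, e m⟫ + μ (e j) (e k) (e l) * ⟪e i, e m⟫
        - μ (e j) (e k) (e m) * ⟪e i, e l⟫)
      + (μ (e k) (e i) (e j) * ⟪e l, e m⟫ + μ (e k) (e i) (e l) * ⟪e j, e m⟫
        - μ (e k) (e i) (e m) * ⟪e j, e l⟫) = 0 := by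
    intro i j k l m
    rw [← K, ← K, ← K, ← mul_add, ← mul_add, ← inner_add_left, ← inner_add_left, hcyc]
    simp
  have A : ∀ i j k, μ (e i) (e j) (e k) = - μ (e j) (e i) (e k) := by
    intro i j k
    have h1 := K (e i) (e j) (e k) (e k) (e k)
    have h2 := K (e j) (e i) (e k) (e k) (e k)
    rw [halt (e i) (e j)] at h1
    simp only [LinearMap.neg_apply, inner_neg_left, he, if_true] at h1 h2
    linarith
  have ex : ∀ i j k : Fin n, ∃ l, l ≠ i ∧ l ≠ j ∧ l ≠ k := by
    intro i j k
    have hc : ({i, j, k} : Finset (Fin n)).card < Fintype.card (Fin n) := by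
      have := Finset.card_le_three (a := i) (b := j) (c := k)
      simp only [Fintype.card_fin]
      omega
    obtain ⟨l, hl⟩ := Finset.exists_mem_notMem_of_card_lt_card (s := {i, j, k})
      (t := Finset.univ) (by simpa using hc)
    refine ⟨l, ?_⟩
    simpa using hl
  have D : ∀ i j k, i ≠ j → i ≠ k → j ≠ k → μ (e i) (e j) (e k) = 0 := by
    intro i j l hij hil hjl
    obtain ⟨k, hki, hkj, hkl⟩ := ex i j l
    have := C i j k l k
    simp only [he] at this
    simpa [hij, hil, hjl, hki, hkj, hkl, hki.symm, hkj.symm, hkl.symm] using this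
  have E : ∀ i j k, i ≠ j → i ≠ k → j ≠ k →
      μ (e i) (e j) (e i) = - μ (e k) (e j) (e k) := by
    intro i j k hij hik hjk
    have := C i j k i k
    simp only [he] at this
    have h2 := A j k k
    simp [hij, hik, hjk, hij.symm, hik.symm, hjk.symm] at this
    linarith
  have F : ∀ i j, μ (e i) (e j) (e i) = 0 := by
    intro i j
    by_cases hij : i = j
    · subst hij
      linarith [A i i i]
    obtain ⟨k, hki, hkj, -⟩ := ex i j j
    obtain ⟨l, hli, hlj, hlk⟩ := ex i j k
    have h1 := E i j k hij hki.symm hkj.symm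
    have h2 := E k j l hkj hlk.symm hlj.symm
    have h3 := E l j i hlj hli (Ne.symm hij)
    linarith
  have Z : ∀ i j k, μ (e i) (e j) (e k) = 0 := by
    intro i j k
    by_cases hij : i = j
    · subst hij
      linarith [A i i k]
    by_cases hik : i = k
    · subst hik
      exact F i j
    by_cases hjk : j = k
    · subst hjk
      rw [A, F, neg_zero]
    exact D i j k hij hik hjk
  let b := (EuclideanSpace.basisFun (Fin n) ℝ).toBasis
  have hb : ∀ i, b i = e i := by
    intro i
    simp [b, e]
  refine b.ext fun i => b.ext fun j => b.ext fun k => b.ext fun l => ?_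
  simp only [hb, LinearMap.zero_apply]
  ext m
  have h := K (e i) (e j) (e k) (e l) (e m)
  simp only [Z] at h
  simpa [e, EuclideanSpace.inner_single_right] using h
end

section
/- Let n ≥ 3. The set of smooth conformal Killing vector fields of the Euclidean metric on ℝⁿ, namely Θ̂ = { ξ : ℝⁿ → ℝⁿ smooth | there exists λ : ℝⁿ → ℝ such that ∂ᵢξʲ(x) + ∂ⱼξⁱ(x) = 2λ(x)δᵢⱼ for all i, j and all x }, is a real vector space of finite dimension (n+1)(n+2)/2, corresponding to n translations, n(n−1)/2 rotations, 1 dilatation and n elations. -/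
namespace CKF

/-- the i-th partial derivative -/
noncomputable def pd {n : ℕ} (i : Fin n) (f : (Fin n → ℝ) → ℝ) (x : Fin n → ℝ) : ℝ :=
  fderiv ℝ f x (Pi.single i (1 : ℝ))

section Calculus
variable {n : ℕ}

theorem pd_add (i : Fin n) {f g : (Fin n → ℝ) → ℝ} (hf : Differentiable ℝ f)
    (hg : Differentiable ℝ g) (x : Fin n → ℝ) :
    pd i (fun y => f y + g y) x = pd i f x + pd i g x := by
  unfold pd
  rw [fderiv_fun_add (hf x) (hg x)]; rfl

theorem pd_sub (i : Fin n) {f g : (Fin n → ℝ) → ℝ} (hf : Differentiable ℝ f)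
    (hg : Differentiable ℝ g) (x : Fin n → ℝ) :
    pd i (fun y => f y - g y) x = pd i f x - pd i g x := by
  unfold pd
  rw [fderiv_fun_sub (hf x) (hg x)]; rfl

theorem pd_mul (i : Fin n) {f g : (Fin n → ℝ) → ℝ} (hf : Differentiable ℝ f)
    (hg : Differentiable ℝ g) (x : Fin n → ℝ) :
    pd i (fun y => f y * g y) x = f x * pd i g x + g x * pd i f x := by
  unfold pd
  rw [fderiv_fun_mul (hf x) (hg x)]; rfl

theorem pd_const (i : Fin n) (c : ℝ) (x : Fin n → ℝ) : pd i (fun _ => c) x = 0 := by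
  simp [pd]

theorem pd_coord (i j : Fin n) (x : Fin n → ℝ) :
    pd i (fun y => y j) x = if i = j then 1 else 0 := by
  unfold pd
  have h : HasFDerivAt (fun y : Fin n → ℝ => y j)
    (ContinuousLinearMap.proj (R := ℝ) (φ := fun _ : Fin n => ℝ) j) x :=
    (ContinuousLinearMap.proj (R := ℝ) (φ := fun _ : Fin n => ℝ) j).hasFDerivAt
  rw [h.fderiv]
  simp [Pi.single_apply, eq_comm]

theorem pd_sum (i : Fin n) {f : Fin n → (Fin n → ℝ) → ℝ} (hf : ∀ k, Differentiable ℝ (f k))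
    (x : Fin n → ℝ) :
    pd i (fun y => ∑ k, f k y) x = ∑ k, pd i (f k) x := by
  unfold pd
  rw [fderiv_fun_sum (fun k _ => hf k x)]
  simp

theorem pd_smooth (i : Fin n) {f : (Fin n → ℝ) → ℝ} (hf : ContDiff ℝ (⊤ : ℕ∞) f) :
    ContDiff ℝ (⊤ : ℕ∞) (pd i f) := by
  unfold pd
  exact (hf.fderiv_right (m := (⊤ : ℕ∞)) (by simp)).clm_apply contDiff_const

theorem pd_comm (i j : Fin n) {f : (Fin n → ℝ) → ℝ} (hf : ContDiff ℝ (⊤ : ℕ∞) f)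
    (x : Fin n → ℝ) : pd i (pd j f) x = pd j (pd i f) x := by
  have h2 : Differentiable ℝ (fderiv ℝ f) :=
    (hf.fderiv_right (m := (⊤ : ℕ∞)) (by simp)).differentiable (by simp)
  have key : ∀ a b : Fin n, pd a (pd b f) x
      = fderiv ℝ (fderiv ℝ f) x (Pi.single a 1) (Pi.single b 1) := by
    intro a b
    unfold pd
    rw [fderiv_clm_apply (h2 x) (differentiableAt_const _)]
    simp
  have hs : IsSymmSndFDerivAt ℝ f x :=
    (hf.contDiffAt).isSymmSndFDerivAt (by
      rw [minSmoothness_of_isRCLikeNormedField]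
      exact WithTop.coe_le_coe.2 (le_top : (2 : ℕ∞) ≤ ⊤))
  rw [key, key]
  exact hs _ _

theorem const_of_pd {f : (Fin n → ℝ) → ℝ} (hf : Differentiable ℝ f)
    (h : ∀ i x, pd i f x = 0) (x : Fin n → ℝ) : f x = f 0 := by
  apply is_const_of_fderiv_eq_zero hf
  intro x
  ext v
  have : v = ∑ i, v i • (Pi.single i (1:ℝ) : Fin n → ℝ) := by
    ext j; simp [Finset.sum_apply, Pi.single_apply]
  rw [this, map_sum]
  simp only [map_smul]
  have h' : ∀ i, fderiv ℝ f x (Pi.single i (1:ℝ)) = 0 := fun i => h i x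
  simp [h']

/-- kronecker delta -/
noncomputable def dl (i j : Fin n) : ℝ := if i = j then 1 else 0

/-- general field -/
noncomputable def fld (a : Fin n → ℝ) (M : Fin n → Fin n → ℝ) (b : Fin n → ℝ)
    (x : Fin n → ℝ) (j : Fin n) : ℝ :=
  a j + (∑ i, M i j * x i) + ((∑ i, b i * x i) * x j - (∑ i, x i * x i) * (b j / 2))

theorem dl_comm (i j : Fin n) : dl i j = dl j i := by simp [dl, eq_comm]

theorem pd_lin (i : Fin n) (c : Fin n → ℝ) (x : Fin n → ℝ) :
    pd i (fun y => ∑ k, c k * y k) x = c i := by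
  rw [pd_sum i (by intro k; fun_prop)]
  have : ∀ k, pd i (fun y => c k * y k) x = if i = k then c k else 0 := by
    intro k
    rw [pd_mul i (by fun_prop) (by fun_prop), pd_const, pd_coord]
    simp
  simp [this]

theorem pd_sq (i : Fin n) (x : Fin n → ℝ) :
    pd i (fun y => ∑ k, y k * y k) x = 2 * x i := by
  rw [pd_sum i (by intro k; fun_prop)]
  have : ∀ k, pd i (fun y => y k * y k) x = if i = k then 2 * x k else 0 := by
    intro k
    rw [pd_mul i (by fun_prop) (by fun_prop), pd_coord]
    split_ifs <;> ring
  simp [this]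

theorem pd_fld (a : Fin n → ℝ) (M : Fin n → Fin n → ℝ) (b : Fin n → ℝ) (i j : Fin n)
    (x : Fin n → ℝ) : pd i (fun y => fld a M b y j) x =
      M i j + (b i * x j + (∑ k, b k * x k) * dl i j - x i * b j) := by
  unfold fld
  rw [pd_add i (by fun_prop) (by fun_prop), pd_add i (by fun_prop) (by fun_prop),
    pd_sub i (by fun_prop) (by fun_prop), pd_mul i (by fun_prop) (by fun_prop),
    pd_mul i (by fun_prop) (by fun_prop), pd_lin i (fun k => M k j), pd_lin, pd_sq,
    pd_const, pd_const, pd_coord, dl]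
  ring

theorem pd_grad (b : Fin n → ℝ) (k i j : Fin n) (x : Fin n → ℝ) :
    pd k (fun x => b i * x j + (∑ k, b k * x k) * dl i j - x i * b j) x =
      b i * dl k j + b k * dl i j - dl k i * b j := by
  rw [pd_sub k (by fun_prop) (by fun_prop), pd_add k (by fun_prop) (by fun_prop),
    pd_mul k (by fun_prop) (by fun_prop), pd_mul k (by fun_prop) (by fun_prop),
    pd_mul k (by fun_prop) (by fun_prop), pd_lin, pd_const, pd_const, pd_const,
    pd_coord, pd_coord, dl, dl, dl]
  ring

theorem fld_smooth (a : Fin n → ℝ) (M : Fin n → Fin n → ℝ) (b : Fin n → ℝ) :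
    ContDiff ℝ (⊤ : ℕ∞) (fld a M b) := by
  rw [contDiff_pi]
  intro j
  unfold fld
  fun_prop

/-- second derivatives from the Killing equation -/
theorem snd (ξ : (Fin n → ℝ) → Fin n → ℝ) (hs : ∀ j, ContDiff ℝ (⊤ : ℕ∞) (fun y => ξ y j))
    (lam : (Fin n → ℝ) → ℝ) (hl : ContDiff ℝ (⊤ : ℕ∞) lam)
    (h : ∀ i j x, pd i (fun y => ξ y j) x + pd j (fun y => ξ y i) x = 2 * lam x * dl i j)
    (k i j : Fin n) (x : Fin n → ℝ) :
    pd k (pd i (fun y => ξ y j)) x =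
      pd i lam x * dl k j + pd k lam x * dl i j - dl k i * pd j lam x := by
  have hd : ∀ i j, Differentiable ℝ (pd i (fun y => ξ y j)) := fun i j =>
    (pd_smooth i (hs j)).differentiable (by simp)
  have hld : Differentiable ℝ lam := hl.differentiable (by simp)
  have H : ∀ k i j, pd k (pd i (fun y => ξ y j)) x + pd k (pd j (fun y => ξ y i)) x
      = 2 * pd k lam x * dl i j := by
    intro k i j
    rw [← pd_add k (hd i j) (hd j i)]
    have : (fun y => pd i (fun y => ξ y j) y + pd j (fun y => ξ y i) y)
      = fun y => lam y * (2 * dl i j) := by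
      funext y; rw [h]; ring
    rw [this, pd_mul k hld (by fun_prop), pd_const]; ring
  have h1 := H k i j
  have h2 := H i j k
  have h3 := H j k i
  have c1 := pd_comm i k (hs j) x
  have c2 := pd_comm i j (hs k) x
  have c3 := pd_comm j k (hs i) x
  rw [dl_comm j k] at h2
  linarith

theorem exists_third (hn : 3 ≤ n) (i l : Fin n) : ∃ j, j ≠ i ∧ j ≠ l := by
  have : ({i, l} : Finset (Fin n)).card < Fintype.card (Fin n) := by
    rw [Fintype.card_fin]
    exact lt_of_le_of_lt (Finset.card_le_two) (by omega)
  obtain ⟨j, hj⟩ := Finset.exists_mem_notMem_of_card_lt_card (s := {i, l}) (t := Finset.univ)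
    (by simpa using this)
  exact ⟨j, by simpa using hj⟩

theorem lam_hess (hn : 3 ≤ n) (ξ : (Fin n → ℝ) → Fin n → ℝ)
    (hs : ∀ j, ContDiff ℝ (⊤ : ℕ∞) (fun y => ξ y j))
    (lam : (Fin n → ℝ) → ℝ) (hl : ContDiff ℝ (⊤ : ℕ∞) lam)
    (h : ∀ i j x, pd i (fun y => ξ y j) x + pd j (fun y => ξ y i) x = 2 * lam x * dl i j)
    (i l : Fin n) (x : Fin n → ℝ) : pd l (pd i lam) x = 0 := by
  have hld : ∀ i, Differentiable ℝ (pd i lam) := fun i =>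
    (pd_smooth i hl).differentiable (by simp)
  have T : ∀ l k i j, pd l (pd k (pd i (fun y => ξ y j))) x =
      pd l (pd i lam) x * dl k j + pd l (pd k lam) x * dl i j - dl k i * pd l (pd j lam) x := by
    intro l k i j
    have e : pd k (pd i (fun y => ξ y j)) = fun x =>
      pd i lam x * dl k j + pd k lam x * dl i j - dl k i * pd j lam x := by
      funext x; exact snd ξ hs lam hl h k i j x
    have d1 := hld i
    have d2 := hld j
    have d3 := hld k
    rw [e, pd_sub l (by fun_prop) (by fun_prop), pd_add l (by fun_prop) (by fun_prop),
      pd_mul l (by fun_prop) (by fun_prop), pd_mul l (by fun_prop) (by fun_prop),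
      pd_mul l (by fun_prop) (by fun_prop), pd_const, pd_const, pd_const]
    ring
  have R : ∀ l k i j, pd l (pd i lam) x * dl k j + pd l (pd k lam) x * dl i j
      - dl k i * pd l (pd j lam) x = pd k (pd i lam) x * dl l j + pd k (pd l lam) x * dl i j
      - dl l i * pd k (pd j lam) x := by
    intro l k i j
    rw [← T, ← T]
    exact pd_comm l k (pd_smooth i (hs j)) x
  have S : ∀ i j l, j ≠ i → j ≠ l → pd l (pd i lam) x = - dl l i * pd j (pd j lam) x := by
    intro i j l h1 h2
    have := R l j i j
    simp only [dl, if_neg h1, if_neg h1.symm, if_neg h2.symm, if_true] at this ⊢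
    linarith
  by_cases hil : l = i
  · subst hil
    obtain ⟨j, hj, -⟩ := exists_third hn l l
    obtain ⟨k, hk, hkj⟩ := exists_third hn l j
    have e1 := S l j l hj hj
    have e2 := S l k l hk hk
    have e3 := S j k j hkj hkj
    simp only [dl, if_true] at e1 e2 e3
    linarith
  · obtain ⟨j, hj, hjl⟩ := exists_third hn i l
    rw [S i j l hj hjl]
    simp [dl, hil]

theorem structure_thm (hn : 3 ≤ n) (ξ : (Fin n → ℝ) → Fin n → ℝ)
    (hs : ∀ j, ContDiff ℝ (⊤ : ℕ∞) (fun y => ξ y j))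
    (lam : (Fin n → ℝ) → ℝ)
    (h : ∀ i j x, pd i (fun y => ξ y j) x + pd j (fun y => ξ y i) x = 2 * lam x * dl i j) :
    ∃ a M b c, (∀ i j, M i j + M j i = 2 * c * dl i j) ∧ ξ = fld a M b := by
  have hl : ContDiff ℝ (⊤ : ℕ∞) lam := by
    have : lam = pd (⟨0, by omega⟩ : Fin n) (fun y => ξ y ⟨0, by omega⟩) := by
      funext x
      have := h ⟨0, by omega⟩ ⟨0, by omega⟩ x
      simp only [dl, if_true] at this
      linarith
    rw [this]
    exact pd_smooth _ (hs _)
  have hb : ∀ i x, pd i lam x = pd i lam 0 := fun i x =>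
    const_of_pd ((pd_smooth i hl).differentiable (by simp))
      (fun l x => lam_hess hn ξ hs lam hl h i l x) x
  set b : Fin n → ℝ := fun i => pd i lam 0 with hbdef
  have hdd : ∀ i j, Differentiable ℝ (pd i (fun y => ξ y j)) := fun i j =>
    (pd_smooth i (hs j)).differentiable (by simp)
  have hM : ∀ i j x, pd i (fun y => ξ y j) x = pd i (fun y => ξ y j) 0 +
      (b i * x j + (∑ k, b k * x k) * dl i j - x i * b j) := by
    intro i j x
    have hd1 := hdd i j
    have := const_of_pd (f := fun x => pd i (fun y => ξ y j) x -
      (b i * x j + (∑ k, b k * x k) * dl i j - x i * b j)) (by fun_prop) (by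
        intro k x
        rw [pd_sub k (by fun_prop) (by fun_prop), pd_grad]
        have := snd ξ hs lam hl h k i j x
        rw [hb i x, hb j x, hb k x] at this
        change pd k (pd i (fun y => ξ y j)) x - _ = 0
        rw [this]; ring) x
    simp at this
    linarith
  refine ⟨ξ 0, fun i j => pd i (fun y => ξ y j) 0, b, lam 0, fun i j => h i j 0, ?_⟩
  funext x j
  have hd1 : Differentiable ℝ (fun y => ξ y j) := (hs j).differentiable (by simp)
  have hd2 : Differentiable ℝ (fun y => fld (ξ 0) (fun i j => pd i (fun y => ξ y j) 0) b y j) := by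
    unfold fld; fun_prop
  have := const_of_pd (f := fun x => ξ x j -
    fld (ξ 0) (fun i j => pd i (fun y => ξ y j) 0) b x j) (by fun_prop) (by
      intro k x
      rw [pd_sub k (by fun_prop) (by fun_prop), pd_fld, hM k j x]; ring) x
  have h0 : fld (ξ 0) (fun i j => pd i (fun y => ξ y j) 0) b 0 j = ξ 0 j := by simp [fld]
  simp only [h0, sub_self] at this
  linarith

/-- pairs i < j -/
abbrev Pr (n : ℕ) := {p : Fin n × Fin n // p.1 < p.2}

/-- skew matrix plus multiple of the identity -/
noncomputable def mat (w : Pr n → ℝ) (c : ℝ) (i j : Fin n) : ℝ :=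
  (if h : i < j then w ⟨(i, j), h⟩ else if h : j < i then - w ⟨(j, i), h⟩ else 0) + c * dl i j

theorem mat_symm (w : Pr n → ℝ) (c : ℝ) (i j : Fin n) :
    mat w c i j + mat w c j i = 2 * c * dl i j := by
  unfold mat
  rw [dl_comm j i]
  rcases lt_trichotomy i j with h | h | h
  · simp [h, h.not_gt]; ring
  · subst h; simp; ring
  · simp [h, h.not_gt]; ring

theorem mat_surj (M : Fin n → Fin n → ℝ) (c : ℝ) (hM : ∀ i j, M i j + M j i = 2 * c * dl i j) :
    M = mat (fun p => M p.1.1 p.1.2) c := by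
  funext i j
  unfold mat
  have := hM i j
  rcases lt_trichotomy i j with h | h | h
  · simp [h, dl, h.ne]
  · subst h; simp [dl] at this ⊢; linarith
  · simp [h, dl, h.ne', h.not_gt] at this ⊢; linarith

/-- parameters -/
abbrev Par (n : ℕ) := (Fin n → ℝ) × (Pr n → ℝ) × ℝ × (Fin n → ℝ)

/-- the parametrization -/
noncomputable def Phi (n : ℕ) : Par n →ₗ[ℝ] ((Fin n → ℝ) → (Fin n → ℝ)) where
  toFun p := fld p.1 (mat p.2.1 p.2.2.1) p.2.2.2
  map_add' p q := by
    funext x j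
    have e : ∀ i, mat (p.2.1 + q.2.1) (p.2.2.1 + q.2.2.1) i j
        = mat p.2.1 p.2.2.1 i j + mat q.2.1 q.2.2.1 i j := by
      intro i
      unfold mat
      split_ifs <;> (try simp only [Pi.add_apply]) <;> ring
    simp only [fld, Prod.fst_add, Prod.snd_add, e, Pi.add_apply, add_mul, Finset.sum_add_distrib]
    ring
  map_smul' r p := by
    funext x j
    have e : ∀ i, mat (r • p.2.1) (r * p.2.2.1) i j = r * mat p.2.1 p.2.2.1 i j := by
      intro i
      unfold mat
      split_ifs <;> (try simp only [Pi.smul_apply, smul_eq_mul]) <;> ring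
    simp only [fld, Prod.smul_fst, Prod.smul_snd, e, Pi.smul_apply, smul_eq_mul, mul_assoc,
      ← Finset.mul_sum, RingHom.id_apply]
    ring

theorem fld_single (a : Fin n → ℝ) (M : Fin n → Fin n → ℝ) (b : Fin n → ℝ) (k j : Fin n)
    (t : ℝ) : fld a M b (Pi.single k t) j =
      a j + t * M k j + t * t * (b k * dl k j - b j / 2) := by
  have e : (Pi.single k t : Fin n → ℝ) j = t * dl k j := by
    simp [Pi.single_apply, dl, eq_comm]
  have e2 : ∑ i, (Pi.single k t : Fin n → ℝ) i * (Pi.single k t : Fin n → ℝ) i = t * t := by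
    simp [Pi.single_apply]
  have e3 : ∀ c : Fin n → ℝ, ∑ i, c i * (Pi.single k t : Fin n → ℝ) i = c k * t := by
    intro c; simp [Pi.single_apply]
  unfold fld
  rw [e2, e3 (fun i => M i j), e3, e]
  ring

theorem Phi_inj (hn : 0 < n) : Function.Injective (Phi n) := by
  rw [← LinearMap.ker_eq_bot, LinearMap.ker_eq_bot']
  rintro ⟨a, w, c, b⟩ hp
  have hz : ∀ k t j, a j + t * mat w c k j + t * t * (b k * dl k j - b j / 2) = 0 := by
    intro k t j
    rw [← fld_single]
    exact congrFun (congrFun hp _) j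
  have ha : ∀ j, a j = 0 := fun j => by have := hz j 0 j; linarith
  have hm : ∀ k j, mat w c k j = 0 := fun k j => by
    have := hz k 1 j; have := hz k (-1) j; linarith
  have hb : ∀ j, b j = 0 := fun j => by
    have h1 := hz j 1 j
    rw [ha, hm] at h1
    simp only [dl, if_true] at h1
    linarith
  have hc : c = 0 := by
    have := hm ⟨0, hn⟩ ⟨0, hn⟩
    simpa [mat, dl] using this
  have hw : w = 0 := by
    funext ⟨⟨i, j⟩, hij⟩
    have := hm i j
    simp only at hij
    simpa [mat, hij, hc] using this
  have ha' : a = 0 := funext ha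
  have hb' : b = 0 := funext hb
  subst ha' hb' hc hw
  rfl

theorem card_Pr : Fintype.card (Pr n) * 2 = n * (n - 1) := by
  let e : Pr n ≃ Σ j : Fin n, Fin (j : ℕ) :=
    { toFun := fun p => ⟨p.1.2, ⟨p.1.1, p.2⟩⟩
      invFun := fun s => ⟨(⟨s.2, s.2.2.trans s.1.2⟩, s.1), s.2.2⟩
      left_inv := fun p => rfl
      right_inv := fun s => rfl }
  rw [Fintype.card_congr e, Fintype.card_sigma]
  simp only [Fintype.card_fin]
  rw [Fin.sum_univ_eq_sum_range (fun i => i) n, Finset.sum_range_id_mul_two]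

theorem dim_Par : Module.finrank ℝ (Par n) = (n + 1) * (n + 2) / 2 := by
  have h := card_Pr (n := n)
  simp only [Par, Module.finrank_prod, Module.finrank_fintype_fun_eq_card, Module.finrank_self,
    Fintype.card_fin]
  cases n with
  | zero => simp at h ⊢
  | succ m =>
    simp only [Nat.add_sub_cancel] at h
    have : (m + 1 + 1) * (m + 1 + 2) = (m+1) * m + 4 * (m + 1) + 2 := by ring
    rw [this, ← h]
    omega

end Calculus

end CKF

/-- for `n ≥ 3`, the space of smooth conformal Killing vector fields of the
Euclidean metric on `ℝⁿ` (those smooth `ξ` for which there is `λ : ℝⁿ → ℝ` with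
`∂ᵢξʲ + ∂ⱼξⁱ = 2λδᵢⱼ`) has dimension `(n+1)(n+2)/2`: `n` translations, `n(n-1)/2`
rotations, `1` dilatation and `n` elations. -/
theorem conformal_killing_fields_dim (n : ℕ) (hn : 3 ≤ n)
    (Θ : Submodule ℝ ((Fin n → ℝ) → (Fin n → ℝ)))
    (hΘ : ∀ ξ : (Fin n → ℝ) → (Fin n → ℝ), ξ ∈ Θ ↔
      (ContDiff ℝ (⊤ : ℕ∞) ξ ∧ ∃ lam : (Fin n → ℝ) → ℝ, ∀ (i j : Fin n) (x : Fin n → ℝ),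
        fderiv ℝ (fun y => ξ y j) x (Pi.single i (1 : ℝ))
          + fderiv ℝ (fun y => ξ y i) x (Pi.single j (1 : ℝ))
          = 2 * lam x * (if i = j then 1 else 0))) :
    Module.finrank ℝ Θ = (n + 1) * (n + 2) / 2 := by
  have hr : Θ = LinearMap.range (CKF.Phi n) := by
    ext ξ
    rw [hΘ, LinearMap.mem_range]
    constructor
    · rintro ⟨hs, lam, h⟩
      obtain ⟨a, M, b, c, hM, hξ⟩ := CKF.structure_thm hn ξ (fun j => contDiff_pi.1 hs j) lam
        (fun i j x => h i j x)
      refine ⟨(a, fun p => M p.1.1 p.1.2, c, b), ?_⟩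
      change CKF.fld a (CKF.mat _ c) b = ξ
      rw [← CKF.mat_surj M c hM, hξ]
    · rintro ⟨⟨a, w, c, b⟩, rfl⟩
      change ContDiff ℝ (⊤ : ℕ∞) (CKF.fld a (CKF.mat w c) b) ∧ _
      refine ⟨CKF.fld_smooth _ _ _, fun x => c + ∑ k, b k * x k, fun i j x => ?_⟩
      have h1 := CKF.pd_fld a (CKF.mat w c) b i j x
      have h2 := CKF.pd_fld a (CKF.mat w c) b j i x
      have h3 := CKF.mat_symm w c i j
      rw [CKF.dl_comm j i] at h2
      change CKF.pd i (fun y => CKF.fld a (CKF.mat w c) b y j) x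
        + CKF.pd j (fun y => CKF.fld a (CKF.mat w c) b y i) x
        = 2 * (c + ∑ k, b k * x k) * CKF.dl i j
      rw [h1, h2]
      linarith
  rw [hr, LinearMap.finrank_range_of_inj (CKF.Phi_inj (by omega)), CKF.dim_Par]
end

section
/- For smooth functions u, v : ℝ² → ℝ define C = ∂₁∂₂u − u − ∂₂∂₂v, U = ∂₁∂₁∂₂∂₂u − ∂₁∂₂∂₂∂₂v − ∂₂∂₂v − u, and V = ∂₁∂₁∂₁∂₂u − ∂₁∂₁u − ∂₁∂₁∂₂∂₂v. Then the identities U = ∂₁∂₂C + C, V = ∂₁∂₁C and C = ∂₂∂₂V − ∂₁∂₂U + U hold; consequently (U = 0 and V = 0) if and only if C = 0. -/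
/-- The partial derivative `∂ᵢf` of a function `f : ℝⁿ → ℝ` (coordinates numbered from 0). -/
noncomputable def pd {n : ℕ} (i : Fin n) (f : (Fin n → ℝ) → ℝ) : (Fin n → ℝ) → ℝ :=
  fun x => fderiv ℝ f x (Pi.single i 1)

theorem pd_smooth {n : ℕ} (i : Fin n) {f : (Fin n → ℝ) → ℝ} (hf : ContDiff ℝ (⊤ : ℕ∞) f) :
    ContDiff ℝ (⊤ : ℕ∞) (pd i f) := by
  unfold pd
  exact (hf.fderiv_right (m := (⊤ : ℕ∞)) (by simp)).clm_apply contDiff_const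

theorem pd_sub {n : ℕ} (i : Fin n) {f g : (Fin n → ℝ) → ℝ} (hf : ContDiff ℝ (⊤ : ℕ∞) f)
    (hg : ContDiff ℝ (⊤ : ℕ∞) g) : pd i (f - g) = pd i f - pd i g := by
  funext x
  simp only [pd, Pi.sub_apply]
  rw [fderiv_sub (hf.differentiable (by simp) x) (hg.differentiable (by simp) x)]
  rfl

theorem pd_add {n : ℕ} (i : Fin n) {f g : (Fin n → ℝ) → ℝ} (hf : ContDiff ℝ (⊤ : ℕ∞) f)
    (hg : ContDiff ℝ (⊤ : ℕ∞) g) : pd i (f + g) = pd i f + pd i g := by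
  funext x
  simp only [pd, Pi.add_apply]
  rw [fderiv_add (hf.differentiable (by simp) x) (hg.differentiable (by simp) x)]
  rfl

theorem pd_zero {n : ℕ} (i : Fin n) : pd i (0 : (Fin n → ℝ) → ℝ) = 0 := by
  funext x
  simp [pd]

theorem pd_comm {n : ℕ} (i j : Fin n) {f : (Fin n → ℝ) → ℝ} (hf : ContDiff ℝ (⊤ : ℕ∞) f) :
    pd i (pd j f) = pd j (pd i f) := by
  funext x
  have hd : DifferentiableAt ℝ (fderiv ℝ f) x :=
    (hf.fderiv_right (m := (⊤ : ℕ∞)) (by simp)).differentiable (by simp) x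
  have key : ∀ a b : Fin n, pd a (pd b f) x
      = fderiv ℝ (fderiv ℝ f) x (Pi.single a 1) (Pi.single b 1) := by
    intro a b
    unfold pd
    rw [fderiv_clm_apply hd (differentiableAt_const _)]
    simp
  rw [key, key]
  have hs : IsSymmSndFDerivAt ℝ f x := hf.contDiffAt.isSymmSndFDerivAt (by
    simp only [minSmoothness_of_isRCLikeNormedField]
    exact WithTop.coe_le_coe.2 (le_top : (2 : ℕ∞) ≤ ⊤))
  exact hs _ _

/-- with `C = ∂₁∂₂u − u − ∂₂∂₂v`,
`U = ∂₁∂₁∂₂∂₂u − ∂₁∂₂∂₂∂₂v − ∂₂∂₂v − u` and `V = ∂₁∂₁∂₁∂₂u − ∂₁∂₁u − ∂₁∂₁∂₂∂₂v`,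
one has `U = ∂₁∂₂C + C`, `V = ∂₁∂₁C` and `C = ∂₂∂₂V − ∂₁∂₂U + U`; consequently
`(U = 0 ∧ V = 0) ↔ C = 0`. (Coordinates: `x¹, x²` correspond to indices `0, 1`.) -/
theorem compatibility_conditions_equivalence (u v : (Fin 2 → ℝ) → ℝ)
    (hu : ContDiff ℝ (⊤ : ℕ∞) u) (hv : ContDiff ℝ (⊤ : ℕ∞) v) :
    let C := pd 0 (pd 1 u) - u - pd 1 (pd 1 v)
    let U := pd 0 (pd 0 (pd 1 (pd 1 u))) - pd 0 (pd 1 (pd 1 (pd 1 v))) - pd 1 (pd 1 v) - u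
    let V := pd 0 (pd 0 (pd 0 (pd 1 u))) - pd 0 (pd 0 u) - pd 0 (pd 0 (pd 1 (pd 1 v)))
    U = pd 0 (pd 1 C) + C ∧
    V = pd 0 (pd 0 C) ∧
    C = pd 1 (pd 1 V) - pd 0 (pd 1 U) + U ∧
    ((U = 0 ∧ V = 0) ↔ C = 0) := by
  intro C U V
  have s : ∀ (i : Fin 2) {f : (Fin 2 → ℝ) → ℝ}, ContDiff ℝ (⊤ : ℕ∞) f →
    ContDiff ℝ (⊤ : ℕ∞) (pd i f) := fun i _ h => pd_smooth i h
  have hCs : ContDiff ℝ (⊤ : ℕ∞) C := ((s 0 (s 1 hu)).sub hu).sub (s 1 (s 1 hv))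
  have e : ∀ i j : Fin 2, pd i (pd j C)
      = pd i (pd j (pd 0 (pd 1 u))) - pd i (pd j u) - pd i (pd j (pd 1 (pd 1 v))) := by
    intro i j
    have a := s 0 (s 1 hu)
    have b := s 1 (s 1 hv)
    change pd i (pd j (pd 0 (pd 1 u) - u - pd 1 (pd 1 v))) = _
    rw [pd_sub j (f := pd 0 (pd 1 u) - u) (a.sub hu) b, pd_sub j a hu,
      pd_sub i (f := pd j (pd 0 (pd 1 u)) - pd j u) ((s j a).sub (s j hu)) (s j b),
      pd_sub i (s j a) (s j hu)]
  have hU : U = pd 0 (pd 1 C) + C := by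
    rw [e, pd_comm 1 0 (s 1 hu)]
    simp only [U, C]
    abel
  have hV : V = pd 0 (pd 0 C) := by rw [e]
  have hC : C = pd 1 (pd 1 V) - pd 0 (pd 1 U) + U := by
    rw [hV, hU, pd_add 1 (s 0 (s 1 hCs)) hCs, pd_add 0 (s 1 (s 0 (s 1 hCs))) (s 1 hCs),
      pd_comm 1 0 (s 0 hCs), pd_comm 1 0 hCs, pd_comm 1 0 (s 0 (s 1 hCs))]
    abel
  refine ⟨hU, hV, hC, ?_, ?_⟩
  · rintro ⟨h1, h2⟩
    rw [hC, h1, h2]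
    simp [pd_zero]
  · intro h
    rw [hU, hV, h]
    simp [pd_zero]
end

section
/- Let γ, ξ : ℝ → ℝ be smooth, set Γ = ξ'' + γξ' + ξγ' and ν = γ' − ½γ². Then Γ' − γΓ = ξ''' + 2νξ' + ξν'. In particular, any ξ satisfying the second order affine Lie equation Γ = 0 also satisfies the third order projective Lie equation ξ''' + 2νξ' + ξν' = 0. -/
/-- with `Γ = ξ'' + γξ' + ξγ'` and `ν = γ' − ½γ²` one has
`Γ' − γΓ = ξ''' + 2νξ' + ξν'`; in particular any `ξ` with `Γ = 0` (the affine Lie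
equation) satisfies the projective Lie equation `ξ''' + 2νξ' + ξν' = 0`. -/
theorem affine_implies_projective (γ ξ : ℝ → ℝ)
    (hγ : ContDiff ℝ (⊤ : ℕ∞) γ) (hξ : ContDiff ℝ (⊤ : ℕ∞) ξ) :
    let Γ : ℝ → ℝ := deriv (deriv ξ) + γ * deriv ξ + ξ * deriv γ
    let ν : ℝ → ℝ := deriv γ - (1 / 2 : ℝ) • γ ^ 2
    (deriv Γ - γ * Γ = deriv (deriv (deriv ξ)) + 2 • (ν * deriv ξ) + ξ * deriv ν) ∧
    (Γ = 0 → deriv (deriv (deriv ξ)) + 2 • (ν * deriv ξ) + ξ * deriv ν = 0) := by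
  intro Γ ν
  have hγ1 : ContDiff ℝ (⊤ : ℕ∞) (deriv γ) := (contDiff_infty_iff_deriv.1 hγ).2
  have hξ1 : ContDiff ℝ (⊤ : ℕ∞) (deriv ξ) := (contDiff_infty_iff_deriv.1 hξ).2
  have hξ2 : ContDiff ℝ (⊤ : ℕ∞) (deriv (deriv ξ)) := (contDiff_infty_iff_deriv.1 hξ1).2
  have key : deriv Γ - γ * Γ
      = deriv (deriv (deriv ξ)) + 2 • (ν * deriv ξ) + ξ * deriv ν := by
    funext x
    have g0 := ((contDiff_infty_iff_deriv.1 hγ).1 x).hasDerivAt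
    have g1 := ((contDiff_infty_iff_deriv.1 hγ1).1 x).hasDerivAt
    have x0 := ((contDiff_infty_iff_deriv.1 hξ).1 x).hasDerivAt
    have x1 := ((contDiff_infty_iff_deriv.1 hξ1).1 x).hasDerivAt
    have x2 := ((contDiff_infty_iff_deriv.1 hξ2).1 x).hasDerivAt
    have hΓ : deriv Γ x = _ := ((x2.add (g0.mul x1)).add (x0.mul g1)).deriv
    have hν : deriv ν x = _ := (g1.sub ((g0.pow 2).const_smul (1 / 2 : ℝ))).deriv
    simp only [Pi.sub_apply, Pi.add_apply, Pi.mul_apply, Pi.smul_apply, hΓ, hν]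
    simp only [Γ, ν, Pi.sub_apply, Pi.add_apply, Pi.mul_apply, Pi.smul_apply, Pi.pow_apply,
      smul_eq_mul, nsmul_eq_mul]
    push_cast
    ring
  refine ⟨key, fun h => ?_⟩
  rw [← key, h]
  funext x
  simp
end
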